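/- arXiv:2001.08104 — 2 statements merged into one kernel-verified Lean document; each statement's English description precedes it below -/
import Mathlib

section
/- The series ∑_{n=0}^∞ ((1/2)_n (1/3)_n (2/3)_n)/((1)_n^3) · (-9/16)^n equals 16π² / (27·Γ(2/3)^6). -/
open Real

noncomputable def poch (a : ℝ) (n : ℕ) : ℝ := (ascPochhammer ℝ n).eval a

open MeasureTheory Set

lemma poch_zero (a : ℝ) : poch a 0 = 1 := by simp [poch]

lemma poch_succ (a : ℝ) (n : ℕ) : poch a (n+1) = poch a n * (a + n) := by
  simp [poch, ascPochhammer_succ_right]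

lemma poch_one (n : ℕ) : poch 1 n = (n.factorial : ℝ) := by
  simp [poch]

lemma poch_pos {a : ℝ} (ha : 0 < a) (n : ℕ) : 0 < poch a n := by
  induction n with
  | zero => simp [poch_zero]
  | succ k ih => rw [poch_succ]; positivity

lemma hasSum_binom (a u : ℝ) (hu : |u| < 1) :
    HasSum (fun n : ℕ => poch a n / poch 1 n * u ^ n) ((1 - u) ^ (-a)) := by
  have h := (Real.one_div_one_sub_rpow_hasFPowerSeriesOnBall_zero a).hasSum (y := u)
    (by simpa [enorm_eq_nnnorm, ← NNReal.coe_lt_coe] using hu)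
  have h1 : 0 ≤ 1 - u := by linarith [(abs_lt.mp hu).2]
  rw [Real.rpow_neg h1]
  have e1 : (fun n : ℕ => poch a n / poch 1 n * u ^ n) = fun n : ℕ =>
      (FormalMultilinearSeries.ofScalars ℝ (fun n : ℕ => Ring.choose (a + n - 1) n) n) fun _ => u := by
    funext n
    have h2 : (n.factorial : ℝ) * Ring.choose (a + n - 1) n = poch a n := by
      have := Ring.factorial_nsmul_multichoose_eq_ascPochhammer a n
      have h3 : Ring.choose (a + n - 1) n = Ring.multichoose a n := by
        rw [Ring.choose]; congr 1; ring
      rw [h3, poch, ← Polynomial.ascPochhammer_smeval_eq_eval, ← this]; simp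
    have h3 : (n.factorial : ℝ) ≠ 0 := by positivity
    simp [FormalMultilinearSeries.ofScalars, ← h2, poch_one]
    field_simp
    simp
  rw [e1, show ((1 - u) ^ a)⁻¹ = 1 / (1 - (0 + u)) ^ a by simp]
  exact h

lemma hasSum_interchange {α : Type*} [MeasurableSpace α] (μ : Measure α) (w u : α → ℝ) (a ρ : ℝ)
    (ha : 0 < a) (hw : Integrable w μ) (hu : AEStronglyMeasurable u μ) (hρ : ρ < 1) (hρ0 : 0 ≤ ρ)
    (hb : ∀ᵐ x ∂μ, |u x| ≤ ρ) :
    HasSum (fun n : ℕ => poch a n / poch 1 n * ∫ x, w x * u x ^ n ∂μ)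
      (∫ x, w x * (1 - u x) ^ (-a) ∂μ) := by
  have hInt : ∀ n : ℕ, Integrable (fun x => w x * u x ^ n) μ := by
    intro n
    refine hw.mul_bdd (c := ρ ^ n) (hu.pow n) ?_
    filter_upwards [hb] with x hx
    rw [norm_pow]; exact pow_le_pow_left₀ (norm_nonneg _) hx n
  have hc : ∀ n : ℕ, 0 < poch a n / poch 1 n := fun n =>
    div_pos (poch_pos ha n) (poch_pos one_pos n)
  have := hasSum_integral_of_summable_integral_norm (μ := μ)
    (F := fun (n : ℕ) x => poch a n / poch 1 n * (w x * u x ^ n))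
    (fun n => (hInt n).const_mul _) ?_
  · simp_rw [integral_const_mul] at this
    have e : ∫ x, w x * (1 - u x) ^ (-a) ∂μ =
        ∫ x, ∑' i : ℕ, poch a i / poch 1 i * (w x * u x ^ i) ∂μ := ?_
    · rw [e]; exact this
    apply integral_congr_ae
    filter_upwards [hb] with x hx
    have h := (hasSum_binom a (u x) (lt_of_le_of_lt hx hρ)).mul_left (w x)
    rw [← h.tsum_eq]
    congr 1; ext n; ring
  · have hs := ((hasSum_binom a ρ (by rw [abs_of_nonneg hρ0]; exact hρ)).mul_right
      (∫ x, ‖w x‖ ∂μ)).summable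
    refine hs.of_nonneg_of_le (fun n => integral_nonneg fun x => norm_nonneg _) (fun n => ?_)
    rw [← integral_const_mul]
    apply integral_mono_ae ((hInt n).const_mul _).norm (hw.norm.const_mul _)
    filter_upwards [hb] with x hx
    simp only [norm_mul, norm_pow, Real.norm_of_nonneg (hc n).le]
    have : ‖u x‖ ^ n ≤ ρ ^ n := pow_le_pow_left₀ (norm_nonneg _) hx n
    have h2 := norm_nonneg (w x)
    have h3 := hc n
    calc _ ≤ poch a n / poch 1 n * (‖w x‖ * ρ ^ n) := by gcongr
      _ = _ := by ring

lemma beta_integrable {p q : ℝ} (hp : 0 < p) (hq : 0 < q) :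
    IntegrableOn (fun t : ℝ => t ^ (p-1) * (1-t) ^ (q-1)) (Ioo 0 1) := by
  have h := Complex.betaIntegral_convergent (u := p) (v := q) (by simpa) (by simpa)
  rw [intervalIntegrable_iff_integrableOn_Ioo_of_le zero_le_one] at h
  have h2 : IntegrableOn (fun t : ℝ => ((t:ℂ)^((p:ℂ)-1) * (1-(t:ℂ))^((q:ℂ)-1)).re) (Ioo 0 1) :=
    h.re
  refine h2.congr_fun ?_ measurableSet_Ioo
  intro t ht
  have h0 : 0 ≤ t := ht.1.le
  have h1 : 0 ≤ 1 - t := by linarith [ht.2]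
  have e1 : (t:ℂ)^((p:ℂ)-1) = ((t^(p-1) : ℝ) : ℂ) := by
    rw [Complex.ofReal_cpow h0]; simp
  have e2 : (1-(t:ℂ))^((q:ℂ)-1) = (((1-t)^(q-1) : ℝ) : ℂ) := by
    rw [Complex.ofReal_cpow h1]; simp
  simp only [e1, e2, ← Complex.ofReal_mul, Complex.ofReal_re]

lemma beta_eval {p q : ℝ} (hp : 0 < p) (hq : 0 < q) :
    ∫ t in Ioo (0:ℝ) 1, t ^ (p-1) * (1-t) ^ (q-1) = Gamma p * Gamma q / Gamma (p+q) := by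
  have h := ProbabilityTheory.beta_eq_betaIntegralReal p q hp hq
  rw [ProbabilityTheory.beta] at h
  rw [h, Complex.betaIntegral, intervalIntegral.integral_of_le zero_le_one,
    integral_Ioc_eq_integral_Ioo]
  have hh := Complex.betaIntegral_convergent (u := p) (v := q) (by simpa) (by simpa)
  rw [intervalIntegrable_iff_integrableOn_Ioo_of_le zero_le_one] at hh
  have h3 := integral_re hh
  simp only [RCLike.re_to_complex] at h3
  rw [← h3]
  refine setIntegral_congr_fun measurableSet_Ioo ?_
  intro t ht
  have h0 : 0 ≤ t := ht.1.le
  have h1 : 0 ≤ 1 - t := by linarith [ht.2]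
  have e1 : (t:ℂ)^((p:ℂ)-1) = ((t^(p-1) : ℝ) : ℂ) := by
    rw [Complex.ofReal_cpow h0]; simp
  have e2 : (1-(t:ℂ))^((q:ℂ)-1) = (((1-t)^(q-1) : ℝ) : ℂ) := by
    rw [Complex.ofReal_cpow h1]; simp
  simp only [e1, e2, ← Complex.ofReal_mul, Complex.ofReal_re]

lemma Gamma_add_nat {p : ℝ} (hp : 0 < p) (n : ℕ) : Gamma (p + n) = poch p n * Gamma p := by
  induction n with
  | zero => simp [poch_zero]
  | succ k ih =>
    rw [poch_succ]
    push_cast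
    rw [← add_assoc, Real.Gamma_add_one (by positivity), ih]; ring

/-- Moments of the beta weight with `p + q = 1`. -/
lemma beta_moment {p q : ℝ} (hp : 0 < p) (hq : 0 < q) (hpq : p + q = 1) (z : ℝ) (n : ℕ) :
    ∫ t in Ioo (0:ℝ) 1, (t ^ (p-1) * (1-t) ^ (q-1)) * (z * t) ^ n
      = Gamma p * Gamma q * (poch p n / poch 1 n * z ^ n) := by
  have h := beta_eval (p := p + n) (q := q) (by positivity) hq
  rw [Gamma_add_nat hp, show p + n + q = 1 + n by rw [← hpq]; ring,
    Gamma_add_nat one_pos, Gamma_one] at h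
  have h2 : ∫ t in Ioo (0:ℝ) 1, (t ^ (p-1) * (1-t) ^ (q-1)) * (z * t) ^ n =
      ∫ t in Ioo (0:ℝ) 1, z ^ n * (t ^ (p+n-1) * (1-t) ^ (q-1)) := by
    refine setIntegral_congr_fun measurableSet_Ioo ?_
    intro t ht
    simp only
    rw [show p + n - 1 = (p - 1) + n by ring, Real.rpow_add ht.1, Real.rpow_natCast]
    ring
  rw [h2, integral_const_mul, h]
  ring

/-- Euler integral. -/
lemma euler_hasSum {a p q : ℝ} (ha : 0 < a) (hp : 0 < p) (hq : 0 < q) (hpq : p + q = 1) (z : ℝ)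
    (hz : |z| < 1) :
    HasSum (fun n : ℕ => poch a n * poch p n / (poch 1 n)^2 * z ^ n)
      ((Gamma p * Gamma q)⁻¹ *
        ∫ t in Ioo (0:ℝ) 1, (t ^ (p-1) * (1-t) ^ (q-1)) * (1 - z * t) ^ (-a)) := by
  have h := hasSum_interchange (volume.restrict (Ioo (0:ℝ) 1))
    (fun t => t ^ (p-1) * (1-t) ^ (q-1)) (fun t => z * t) a |z| ha (beta_integrable hp hq)
    (by fun_prop) hz (abs_nonneg _) (by
      refine (ae_restrict_iff' measurableSet_Ioo).2 (Filter.Eventually.of_forall ?_)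
      intro t ht
      rw [abs_mul, abs_of_pos ht.1]
      exact mul_le_of_le_one_right (abs_nonneg _) ht.2.le)
  simp only [beta_moment hp hq hpq] at h
  have h2 := h.mul_left (Gamma p * Gamma q)⁻¹
  refine h2.congr_fun ?_
  intro n
  have := (Gamma_pos_of_pos hp).ne'
  have := (Gamma_pos_of_pos hq).ne'
  field_simp

lemma cos_moment_odd (k : ℕ) : ∫ x in (0:ℝ)..π, cos x ^ (2*k+1) = 0 := by
  induction k with
  | zero => simp
  | succ k ih =>
    rw [show 2*(k+1)+1 = (2*k+1)+2 by ring, integral_cos_pow, ih]; simp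

lemma cos_moment_even (k : ℕ) :
    ∫ x in (0:ℝ)..π, cos x ^ (2*k) = π * (poch (1/2) k / poch 1 k) := by
  induction k with
  | zero => simp [poch_zero]
  | succ k ih =>
    rw [show 2*(k+1) = (2*k)+2 by ring, integral_cos_pow, ih, poch_succ, poch_succ]
    have := (poch_pos one_pos k).ne'
    simp
    field_simp
    ring

lemma poch_dup (k : ℕ) : poch (1/3) (2*k) * poch (1/2) k * poch 1 k
    = poch (1/6) k * poch (2/3) k * poch 1 (2*k) := by
  induction k with
  | zero => simp [poch_zero]
  | succ k ih =>
    rw [show 2*(k+1) = (2*k)+1+1 by ring]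
    simp only [poch_succ]
    push_cast
    linear_combination ((1/3:ℝ)+2*k)*(1/3+2*k+1)*(1/2+k)*(1+k) * ih

lemma laplace_hasSum :
    HasSum (fun k : ℕ => poch (1/6) k * poch (2/3) k / (poch 1 k)^2 * (9/25:ℝ)^k)
      (π⁻¹ * ∫ x in Ioo 0 π, (1 + 3/5 * cos x) ^ (-(1/3):ℝ)) := by
  have h := hasSum_interchange (volume.restrict (Ioo (0:ℝ) π))
    (fun _ => 1) (fun x => -(3/5) * cos x) (1/3) (3/5) (by norm_num)
    (integrableOn_const (by simp)) 
    (by fun_prop) (by norm_num) (by norm_num) (by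
      refine Filter.Eventually.of_forall ?_
      intro t
      rw [abs_mul, abs_neg, abs_of_pos (by norm_num : (0:ℝ) < 3/5)]
      have := abs_cos_le_one t
      linarith)
  have hm : ∀ n : ℕ, ∫ x in Ioo 0 π, 1 * (-(3/5) * cos x) ^ n =
      (-(3/5))^n * ∫ x in (0:ℝ)..π, cos x ^ n := by
    intro n
    rw [← integral_Ioc_eq_integral_Ioo, ← intervalIntegral.integral_of_le pi_pos.le,
      ← intervalIntegral.integral_const_mul]
    simp only [one_mul, mul_pow]
  simp only [hm] at h
  have hinj : Function.Injective (fun k : ℕ => 2 * k) := fun a b hab => by simpa using hab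
  rw [← hinj.hasSum_iff] at h
  · have h2 := h.mul_left π⁻¹
    simp only [one_mul, neg_mul, sub_neg_eq_add] at h2
    refine h2.congr_fun ?_
    intro k
    simp only [Function.comp]
    rw [cos_moment_even]
    have e : (-(3/5) : ℝ)^(2*k) = (9/25)^k := by rw [pow_mul]; norm_num
    rw [e]
    have := (poch_pos one_pos k).ne'
    have := (poch_pos one_pos (2*k)).ne'
    have := pi_pos.ne'
    have h3 := poch_dup k
    field_simp
    linear_combination -h3
  · intro n hn
    have : Odd n := by
      rw [← Nat.not_even_iff_odd]
      rintro ⟨k, hk⟩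
      exact hn ⟨k, by simp; omega⟩
    obtain ⟨k, rfl⟩ := this
    simp [cos_moment_odd]

lemma rpow_aux1 : (25/16:ℝ) ^ (-(1/6):ℝ) = (5/4:ℝ) ^ (-(1/3):ℝ) := by
  rw [show (25/16:ℝ) = (5/4) ^ (2:ℝ) by norm_num, ← Real.rpow_mul (by norm_num)]
  norm_num

lemma pfaff_hasSum :
    HasSum (fun k : ℕ => poch (1/6) k * poch (1/3) k / (poch 1 k)^2 * (-9/16:ℝ)^k)
      (π⁻¹ * ∫ x in Ioo 0 π, (5/4 + 3/4 * cos x) ^ (-(1/3):ℝ)) := by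
  have h1 := euler_hasSum (a := 1/6) (p := 1/3) (q := 2/3) (by norm_num) (by norm_num)
    (by norm_num) (by norm_num) (-9/16) (by rw [abs_lt]; norm_num)
  have h2 := euler_hasSum (a := 1/6) (p := 2/3) (q := 1/3) (by norm_num) (by norm_num)
    (by norm_num) (by norm_num) (9/25) (by rw [abs_lt]; norm_num)
  have h3 := h2.unique laplace_hasSum
  have e1 : ∫ x in Ioo 0 π, (5/4 + 3/4 * cos x) ^ (-(1/3):ℝ) =
      (5/4:ℝ) ^ (-(1/3):ℝ) * ∫ x in Ioo 0 π, (1 + 3/5 * cos x) ^ (-(1/3):ℝ) := by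
    rw [← integral_const_mul]
    congr 1; ext x
    rw [← Real.mul_rpow (by norm_num) (by linarith [neg_one_le_cos x])]
    congr 1; ring
  have e2 : ∫ t in Ioo (0:ℝ) 1, (t ^ ((1/3:ℝ)-1) * (1-t) ^ ((2/3:ℝ)-1)) * (1 - (-9/16) * t) ^ (-(1/6):ℝ)
      = (5/4:ℝ) ^ (-(1/3):ℝ) * ∫ t in Ioo (0:ℝ) 1, (t ^ ((2/3:ℝ)-1) * (1-t) ^ ((1/3:ℝ)-1)) * (1 - (9/25) * t) ^ (-(1/6):ℝ) := by
    rw [← integral_const_mul, ← integral_Ioc_eq_integral_Ioo, ← integral_Ioc_eq_integral_Ioo,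
      ← intervalIntegral.integral_of_le zero_le_one, ← intervalIntegral.integral_of_le zero_le_one]
    have := intervalIntegral.integral_comp_sub_left (a := 0) (b := 1) (fun t : ℝ => (t ^ ((1/3:ℝ)-1) * (1-t) ^ ((2/3:ℝ)-1)) * (1 - (-9/16) * t) ^ (-(1/6):ℝ)) 1
    rw [sub_self, sub_zero] at this
    rw [← this]
    apply intervalIntegral.integral_congr
    intro t ht
    rw [uIcc_of_le zero_le_one] at ht
    simp only
    rw [← rpow_aux1, show 1 - (-9/16) * (1 - t) = 25/16 * (1 - 9/25 * t) by ring,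
      Real.mul_rpow (by norm_num) (by linarith [ht.2]), sub_sub_cancel]
    ring
  rw [e2] at h1
  rw [e1]
  convert h1 using 1
  rw [mul_left_comm, ← h3]
  ring

noncomputable def thetaOp (f : PowerSeries ℝ) : PowerSeries ℝ :=
  PowerSeries.X * PowerSeries.derivative ℝ f

lemma thetaOp_coeff (f : PowerSeries ℝ) (n : ℕ) :
    PowerSeries.coeff n (thetaOp f) = n * PowerSeries.coeff n f := by
  cases n with
  | zero => simp [thetaOp]
  | succ n =>
    rw [thetaOp, PowerSeries.coeff_succ_X_mul, PowerSeries.coeff_derivative]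
    push_cast; ring

lemma thetaOp_mul (f g : PowerSeries ℝ) : thetaOp (f * g) = thetaOp f * g + f * thetaOp g := by
  simp only [thetaOp, Derivation.leibniz, smul_eq_mul]; ring

lemma thetaOp_add (f g : PowerSeries ℝ) : thetaOp (f + g) = thetaOp f + thetaOp g := by
  simp only [thetaOp, map_add]; ring

lemma thetaOp_X : thetaOp PowerSeries.X = PowerSeries.X := by
  simp [thetaOp]

lemma thetaOp_nat (n : ℕ) : thetaOp (n : PowerSeries ℝ) = 0 := by
  rw [thetaOp, Derivation.map_natCast, mul_zero]

lemma thetaOp_9 : thetaOp 9 = 0 := by exact_mod_cast thetaOp_nat 9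

lemma thetaOp_18 : thetaOp 18 = 0 := by exact_mod_cast thetaOp_nat 18

lemma clausen_ode (F : PowerSeries ℝ)
    (hF : 18 * thetaOp (thetaOp F) = PowerSeries.X *
      (18 * thetaOp (thetaOp F) + 9 * thetaOp F + F)) :
    18 * thetaOp (thetaOp (thetaOp (F * F))) = PowerSeries.X *
      (18 * thetaOp (thetaOp (thetaOp (F * F))) + 27 * thetaOp (thetaOp (F * F))
        + 13 * thetaOp (F * F) + 2 * (F * F)) := by
  have h2 := congrArg thetaOp hF
  simp only [thetaOp_mul, thetaOp_add, thetaOp_X, thetaOp_9, thetaOp_18] at h2 ⊢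
  linear_combination 6 * thetaOp F * hF + 2 * F * h2

noncomputable def aco (k : ℕ) : ℝ := poch (1/6) k * poch (1/3) k / (poch 1 k)^2

noncomputable def cco (n : ℕ) : ℝ := poch (1/2) n * poch (1/3) n * poch (2/3) n / (poch 1 n)^3

lemma aco_succ (k : ℕ) : 18 * (k+1:ℝ)^2 * aco (k+1) = (18 * k^2 + 9 * k + 1) * aco k := by
  have := (poch_pos one_pos k).ne'
  simp only [aco, poch_succ]
  field_simp
  ring

lemma cco_succ (k : ℕ) : 18 * (k+1:ℝ)^3 * cco (k+1) = (18 * k^3 + 27 * k^2 + 13 * k + 2) * cco k := by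
  have := (poch_pos one_pos k).ne'
  simp only [cco, poch_succ]
  field_simp
  ring

lemma coeff_nat_mul (m n : ℕ) (f : PowerSeries ℝ) :
    PowerSeries.coeff n ((m : PowerSeries ℝ) * f) = m * PowerSeries.coeff n f := by
  rw [← nsmul_eq_mul, map_nsmul, nsmul_eq_mul]

lemma coeff_18_mul (n : ℕ) (f : PowerSeries ℝ) :
    PowerSeries.coeff n (18 * f) = 18 * PowerSeries.coeff n f := by
  exact_mod_cast coeff_nat_mul 18 n f

lemma coeff_9_mul (n : ℕ) (f : PowerSeries ℝ) :
    PowerSeries.coeff n (9 * f) = 9 * PowerSeries.coeff n f := by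
  exact_mod_cast coeff_nat_mul 9 n f

lemma coeff_27_mul (n : ℕ) (f : PowerSeries ℝ) :
    PowerSeries.coeff n (27 * f) = 27 * PowerSeries.coeff n f := by
  exact_mod_cast coeff_nat_mul 27 n f

lemma coeff_13_mul (n : ℕ) (f : PowerSeries ℝ) :
    PowerSeries.coeff n (13 * f) = 13 * PowerSeries.coeff n f := by
  exact_mod_cast coeff_nat_mul 13 n f

lemma coeff_2_mul (n : ℕ) (f : PowerSeries ℝ) :
    PowerSeries.coeff n (2 * f) = 2 * PowerSeries.coeff n f := by
  exact_mod_cast coeff_nat_mul 2 n f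

lemma clausen (n : ℕ) : ∑ p ∈ Finset.HasAntidiagonal.antidiagonal n, aco p.1 * aco p.2 = cco n := by
  have hode := clausen_ode (PowerSeries.mk aco) (by
    ext n
    cases n with
    | zero => rw [coeff_18_mul, thetaOp_coeff, PowerSeries.coeff_zero_X_mul]; simp
    | succ k =>
      rw [PowerSeries.coeff_succ_X_mul]
      simp only [map_add, coeff_18_mul, coeff_9_mul, coeff_27_mul, coeff_13_mul, coeff_2_mul, thetaOp_coeff, PowerSeries.coeff_mk]
      push_cast
      linear_combination aco_succ k)
  set G := PowerSeries.mk aco * PowerSeries.mk aco with hG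
  have hg : ∀ n, PowerSeries.coeff n G = ∑ p ∈ Finset.HasAntidiagonal.antidiagonal n, aco p.1 * aco p.2 := by
    intro n
    simp [hG, PowerSeries.coeff_mul]
  rw [← hg]
  induction n with
  | zero => simp [hg, aco, cco, poch_zero]
  | succ k ih =>
    have h := congrArg (PowerSeries.coeff (k+1)) hode
    rw [PowerSeries.coeff_succ_X_mul] at h
    simp only [map_add, coeff_18_mul, coeff_9_mul, coeff_27_mul, coeff_13_mul, coeff_2_mul, thetaOp_coeff] at h
    push_cast at h
    have h2 := cco_succ k
    rw [← ih] at h2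
    have h3 : (18 * (k+1:ℝ)^3) ≠ 0 := by positivity
    apply mul_left_cancel₀ h3
    linear_combination h - h2

lemma clausen_tsum : ∑' n : ℕ, cco n * (-9/16:ℝ)^n =
    (∑' n : ℕ, aco n * (-9/16:ℝ)^n) ^ 2 := by
  have hs : Summable (fun n : ℕ => ‖aco n * (-9/16:ℝ)^n‖) := by
    have h := (euler_hasSum (a := 1/6) (p := 1/3) (q := 2/3) (by norm_num) (by norm_num)
      (by norm_num) (by norm_num) (9/16) (by rw [abs_lt]; norm_num)).summable
    refine h.congr ?_
    intro n
    have h1 := poch_pos (a := 1/6) (by norm_num) n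
    have h2 := poch_pos (a := 1/3) (by norm_num) n
    have h3 := poch_pos one_pos n
    rw [norm_mul, norm_pow, aco, Real.norm_of_nonneg (by positivity)]
    norm_num
  rw [sq, tsum_mul_tsum_eq_tsum_sum_antidiagonal_of_summable_norm hs hs]
  congr 1; ext n
  rw [← clausen, Finset.sum_mul]
  refine Finset.sum_congr rfl ?_
  intro p hp
  rw [← Finset.HasAntidiagonal.mem_antidiagonal.mp hp, pow_add]
  ring

lemma cov {f f' g h : ℝ → ℝ} {S T : Set ℝ} (hS : MeasurableSet S)
    (hf : ∀ x ∈ S, HasDerivAt f (f' x) x) (hinj : InjOn f S) (hT : f '' S = T)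
    (hgh : ∀ x ∈ S, |f' x| * g (f x) = h x) :
    (∫ x in T, g x = ∫ x in S, h x) ∧ (IntegrableOn g T ↔ IntegrableOn h S) := by
  subst hT
  constructor
  · rw [integral_image_eq_integral_abs_deriv_smul hS (fun x hx => (hf x hx).hasDerivWithinAt) hinj]
    exact setIntegral_congr_fun hS hgh
  · rw [integrableOn_image_iff_integrableOn_abs_deriv_smul hS
      (fun x hx => (hf x hx).hasDerivWithinAt) hinj]
    exact integrableOn_congr_fun hgh hS

noncomputable def gq (q : ℝ) : ℝ := q ^ (-(1/3):ℝ) / √((2-q)*(q-1/2))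

noncomputable def Dr (r : ℝ) : ℝ := (2 - r^3) * (r^3 - 1/2)

lemma step1 : (∫ q in Ioo (1/2:ℝ) 2, gq q = ∫ x in Ioo 0 π, (5/4 + 3/4 * cos x) ^ (-(1/3):ℝ))
    ∧ IntegrableOn gq (Ioo (1/2:ℝ) 2) := by
  have h := cov (f := fun x => 5/4 + 3/4 * cos x) (f' := fun x => -(3/4 * sin x)) (g := gq)
    (h := fun x => (5/4 + 3/4 * cos x) ^ (-(1/3):ℝ)) (S := Ioo 0 π) (T := Ioo (1/2:ℝ) 2)
    measurableSet_Ioo ?_ ?_ ?_ ?_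
  · refine ⟨h.1, h.2.2 ?_⟩
    have : ContinuousOn (fun x => (5/4 + 3/4 * cos x) ^ (-(1/3):ℝ)) (Icc 0 π) := by
      apply ContinuousOn.rpow_const (by fun_prop)
      intro x _
      left
      linarith [neg_one_le_cos x]
    exact (this.integrableOn_Icc).mono_set Ioo_subset_Icc_self
  · intro x _
    have := ((hasDerivAt_cos x).const_mul (3/4)).const_add (5/4)
    simpa using this
  · intro x hx y hy hxy
    have : cos x = cos y := by simp only at hxy; linarith
    exact injOn_cos (Ioo_subset_Icc_self hx) (Ioo_subset_Icc_self hy) this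
  · ext q
    constructor
    · rintro ⟨x, hx, rfl⟩
      have h1 : cos x < 1 := by
        have := strictAntiOn_cos (left_mem_Icc.2 pi_pos.le) (Ioo_subset_Icc_self hx) hx.1
        simpa using this
      have h2 : -1 < cos x := by
        have := strictAntiOn_cos (Ioo_subset_Icc_self hx) (right_mem_Icc.2 pi_pos.le) hx.2
        simpa using this
      constructor <;> simp only <;> linarith
    · intro hq
      refine ⟨arccos (4/3 * (q - 5/4)), ⟨?_, ?_⟩, ?_⟩
      · rw [arccos_pos]; linarith [hq.2]
      · rw [← arccos_neg_one]
        exact strictAntiOn_arccos (by constructor <;> norm_num)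
          (by constructor <;> linarith [hq.1, hq.2]) (by linarith [hq.1])
      · simp only
        rw [cos_arccos (by linarith [hq.1]) (by linarith [hq.2])]; ring
  · intro x hx
    have hs := sin_pos_of_pos_of_lt_pi hx.1 hx.2
    simp only [gq]
    have e : (2 - (5/4 + 3/4 * cos x)) * (5/4 + 3/4 * cos x - 1/2) = (3/4 * sin x)^2 := by
      have := sin_sq_add_cos_sq x
      linear_combination (9/16) * (-this)
    rw [e, sqrt_sq (by positivity), abs_neg, abs_of_pos (by positivity)]
    field_simp

lemma step2 {c : ℝ} (hc : c^3 = 2) (hc1 : 1 < c) :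
    (∫ q in Ioo (1:ℝ) 2, gq q = ∫ r in Ioo 1 c, 3 * r / √(Dr r))
    ∧ (IntegrableOn gq (Ioo (1:ℝ) 2) ↔ IntegrableOn (fun r => 3 * r / √(Dr r)) (Ioo 1 c)) := by
  refine cov (f := fun r => r^3) (f' := fun r => 3 * r^2) measurableSet_Ioo ?_ ?_ ?_ ?_
  · intro x _
    simpa using hasDerivAt_pow 3 x
  · intro x hx y hy hxy
    exact (pow_left_inj₀ (by linarith [hx.1]) (by linarith [hy.1]) (by norm_num)).1 hxy
  · ext q
    constructor
    · rintro ⟨x, hx, rfl⟩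
      refine ⟨one_lt_pow₀ hx.1 (by norm_num), ?_⟩
      rw [← hc]
      exact pow_lt_pow_left₀ hx.2 (by linarith [hx.1]) (by norm_num)
    · intro hq
      have h := intermediate_value_Ioo hc1.le (f := fun r : ℝ => r^3) (by fun_prop)
      simp only [hc, one_pow] at h
      exact h hq
  · intro r hr
    have h0 : 0 < r := by linarith [hr.1]
    simp only [gq, Dr]
    have e : ((r^3:ℝ)) ^ (-(1/3):ℝ) = r⁻¹ := by
      rw [← Real.rpow_natCast, ← Real.rpow_mul h0.le, ← Real.rpow_neg_one]; norm_num
    rw [e, abs_of_pos (by positivity)]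
    field_simp

lemma step3 {c : ℝ} (hc : c^3 = 2) (hc1 : 1 < c) :
    (∫ q in Ioo (1/2:ℝ) 1, gq q = ∫ r in Ioo 1 c, 3 / √(Dr r))
    ∧ (IntegrableOn gq (Ioo (1/2:ℝ) 1) ↔ IntegrableOn (fun r => 3 / √(Dr r)) (Ioo 1 c)) := by
  refine cov (f := fun r => (r^3)⁻¹) (f' := fun r => - (3 * r^2) / (r^3)^2) measurableSet_Ioo ?_ ?_ ?_ ?_
  · intro x hx
    have h0 : x ≠ 0 := by linarith [hx.1]
    have h := (hasDerivAt_pow 3 x).inv (pow_ne_zero 3 h0)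
    norm_num at h
    exact h
  · intro x hx y hy hxy
    exact (pow_left_inj₀ (by linarith [hx.1]) (by linarith [hy.1]) (by norm_num)).1 (inv_inj.1 hxy)
  · ext q
    constructor
    · rintro ⟨x, hx, rfl⟩
      have h1 : 1 < x^3 := one_lt_pow₀ hx.1 (by norm_num)
      have h2 : x^3 < 2 := by
        rw [← hc]
        exact pow_lt_pow_left₀ hx.2 (by linarith [hx.1]) (by norm_num)
      constructor
      · simp only [one_div]
        exact inv_strictAnti₀ (by linarith) h2
      · exact inv_lt_one_of_one_lt₀ h1
    · intro hq
      have h := intermediate_value_Ioo hc1.le (f := fun r : ℝ => r^3) (by fun_prop)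
      simp only [hc, one_pow] at h
      have hq0 : 0 < q := by linarith [hq.1]
      have : q⁻¹ ∈ Ioo (1:ℝ) 2 := by
        refine ⟨(one_lt_inv₀ hq0).2 hq.2, ?_⟩
        rw [inv_lt_comm₀ hq0 (by norm_num)]
        simpa using hq.1
      obtain ⟨r, hr, hr2⟩ := h this
      exact ⟨r, hr, by simp only at hr2 ⊢; rw [hr2, inv_inv]⟩
  · intro r hr
    have h0 : 0 < r := by linarith [hr.1]
    simp only [gq]
    have e : ((r^3)⁻¹:ℝ) ^ (-(1/3):ℝ) = r := by
      rw [← Real.rpow_natCast, ← Real.rpow_neg h0.le, ← Real.rpow_mul h0.le]; norm_num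
    have e2 : (2 - (r^3)⁻¹) * ((r^3)⁻¹ - 1/2) = Dr r / (r^3)^2 := by
      simp only [Dr]; field_simp
    rw [e, e2, sqrt_div' _ (by positivity), sqrt_sq (by positivity), neg_div, abs_neg,
      abs_of_pos (by positivity)]
    field_simp

lemma step23 {c : ℝ} (hc : c^3 = 2) (hc1 : 1 < c) :
    ∫ q in Ioo (1/2:ℝ) 2, gq q = ∫ r in Ioo 1 c, 3 * (r+1) / √(Dr r) := by
  have hi := step1.2
  have h2 := step2 hc hc1
  have h3 := step3 hc hc1
  have i2 : IntegrableOn gq (Ioo (1:ℝ) 2) := hi.mono_set (Ioo_subset_Ioo_left (by norm_num))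
  have i3 : IntegrableOn gq (Ioo (1/2:ℝ) 1) := hi.mono_set (Ioo_subset_Ioo_right (by norm_num))
  have e : ∫ q in Ioo (1/2:ℝ) 2, gq q = (∫ q in Ioo (1/2:ℝ) 1, gq q) + ∫ q in Ioo (1:ℝ) 2, gq q := by
    simp only [← integral_Ioc_eq_integral_Ioo]
    rw [← setIntegral_union (by rw [Set.disjoint_left]; intro x hx hy; linarith [hx.2, hy.1]) measurableSet_Ioc
      ((integrableOn_Ioc_iff_integrableOn_Ioo (by simp)).2 i3)
      ((integrableOn_Ioc_iff_integrableOn_Ioo (by simp)).2 i2),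
      Ioc_union_Ioc_eq_Ioc (by norm_num) (by norm_num)]
  rw [e, h2.1, h3.1, ← integral_add (h3.2.1 i3) (h2.2.1 i2)]
  congr 1; ext r; ring

noncomputable def Er (r : ℝ) : ℝ := 1 + 24 * ((r-1)^2/r)^2 + 16 * ((r-1)^2/r)^3

noncomputable def Zr (c r : ℝ) : ℝ :=
  (4*r/(r-1)^2 - 24 - 96 * (r-1)^2/r - 32 * (r-1)^4/r^2) / (36*c)

lemma Zr_deriv {c r : ℝ} (hc1 : 1 < c) (hr : 1 < r) :
    HasDerivAt (Zr c) (-(Er r * (r+1)/(9*c*(r-1)^3))) r := by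
  have h0 : r ≠ 0 := by linarith
  have h1 : r - 1 ≠ 0 := by linarith
  have hc0 : c ≠ 0 := by linarith
  have d1 : HasDerivAt (fun r : ℝ => r - 1) 1 r := (hasDerivAt_id r).sub_const 1
  have dA := ((hasDerivAt_id r).const_mul 4).div (d1.pow 2) (pow_ne_zero 2 h1)
  have dB := ((d1.pow 2).const_mul 96).div (hasDerivAt_id r) h0
  have dC := ((d1.pow 4).const_mul 32).div ((hasDerivAt_id r).pow 2) (pow_ne_zero 2 h0)
  have := (((dA.sub_const 24).sub dB).sub dC).div_const (36*c)
  convert! this using 1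
  simp [Er]
  field_simp
  ring

lemma Zr_cube {c r : ℝ} (hc : c^3 = 2) (hr : 1 < r) :
    Zr c r ^ 3 - 1 = Dr r * (Er r / (27*(r-1)^3))^2 := by
  have h0 : r ≠ 0 := by linarith
  have h1 : r - 1 ≠ 0 := by linarith
  rw [Zr, div_pow, mul_pow, hc, Dr, Er]
  field_simp
  ring

lemma step4 {c : ℝ} (hc : c^3 = 2) (hc1 : 1 < c) :
    c * ∫ z in Ioi (1:ℝ), 1 / √(z^3 - 1) = ∫ r in Ioo 1 c, 3 * (r+1) / √(Dr r) := by
  have hE : ∀ r : ℝ, 1 < r → 0 < Er r := by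
    intro r hr
    have : 0 < r := by linarith
    simp only [Er]; positivity
  have hD : ∀ r ∈ Ioo 1 c, 0 < Dr r := by
    intro r hr
    have h1 : 1 < r^3 := one_lt_pow₀ hr.1 (by norm_num)
    have h2 : r^3 < 2 := by
      rw [← hc]
      exact pow_lt_pow_left₀ hr.2 (by linarith [hr.1]) (by norm_num)
    exact mul_pos (by linarith) (by linarith)
  have hc0 : 0 < c := by linarith
  rw [← integral_const_mul]
  refine (cov (f := Zr c) (f' := fun r => (-(Er r * (r+1)/(9*c*(r-1)^3)))) measurableSet_Ioo
    (fun r hr => Zr_deriv hc1 hr.1) ?_ ?_ ?_).1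
  · apply StrictAntiOn.injOn
    refine strictAntiOn_of_deriv_neg (convex_Ioo 1 c)
      (fun r hr => (Zr_deriv hc1 hr.1).continuousAt.continuousWithinAt) ?_
    intro r hr
    rw [interior_Ioo] at hr
    rw [(Zr_deriv hc1 hr.1).deriv]
    have h1 : 0 < r - 1 := by linarith [hr.1]
    have h2 : 0 < r := by linarith [hr.1]
    have h3 := hE r hr.1
    have : 0 < Er r * (r+1)/(9*c*(r-1)^3) := by positivity
    linarith
  · ext y
    constructor
    · rintro ⟨r, hr, rfl⟩
      have h1 : 0 < r - 1 := by linarith [hr.1]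
      have h3 := hE r hr.1
      have h4 := hD r hr
      have h := Zr_cube hc hr.1
      have h5 : 0 < Dr r * (Er r / (27*(r-1)^3))^2 := by positivity
      rw [mem_Ioi]
      by_contra hlt
      push Not at hlt
      have : Zr c r ^ 3 ≤ 1 ^ 3 := (Odd.pow_le_pow (by decide)).2 hlt
      linarith
    · intro hy
      rw [mem_Ioi] at hy
      have hiv := intermediate_value_Ioo' hc1.le (f := fun r : ℝ =>
        -(8*(r-1)^6+24*r*(r-1)^4+6*r^2*(r-1)^2-r^3) - 9*c*y*r^2*(r-1)^2) (by fun_prop)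
      have : (0:ℝ) ∈ Ioo (-(8*(c-1)^6+24*c*(c-1)^4+6*c^2*(c-1)^2-c^3) - 9*c*y*c^2*(c-1)^2)
        (-(8*(1-1)^6+24*1*(1-1)^4+6*1^2*(1-1)^2-1^3) - 9*c*y*1^2*(1-1)^2) := by
        refine ⟨?_, by norm_num⟩
        have e : -(8*(c-1)^6+24*c*(c-1)^4+6*c^2*(c-1)^2-c^3) - 9*c*y*c^2*(c-1)^2
          = 18 * (c-1)^2 * (1-y) := by
          linear_combination (-(8*c^3-24*c^2+30*c-13) - 9*y*(c-1)^2) * hc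
        rw [e]
        have : 0 < (c-1)^2 := by
          have : 0 < c - 1 := by linarith
          positivity
        nlinarith
      obtain ⟨r, hr, hr2⟩ := hiv this
      refine ⟨r, hr, ?_⟩
      have h0 : r ≠ 0 := by linarith [hr.1]
      have h1 : r - 1 ≠ 0 := by linarith [hr.1]
      simp only [Zr]
      simp only at hr2
      field_simp
      linear_combination 4 * hr2
  · intro r hr
    have h1 : 0 < r - 1 := by linarith [hr.1]
    have h2 : 0 < r := by linarith [hr.1]
    have h3 := hE r hr.1
    have h4 := hD r hr
    rw [Zr_cube hc hr.1, sqrt_mul h4.le, sqrt_sq (by positivity), abs_neg,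
      abs_of_pos (by positivity)]
    have := sqrt_pos.2 h4
    field_simp
    norm_num

lemma step5 : ∫ z in Ioi (1:ℝ), 1 / √(z^3 - 1) = Gamma (1/6) * Gamma (1/2) / Gamma (2/3) / 3 := by
  have hb := beta_eval (p := 1/6) (q := 1/2) (by norm_num) (by norm_num)
  rw [show (1/6:ℝ) + 1/2 = 2/3 by norm_num] at hb
  rw [← hb, eq_div_iff (by norm_num), mul_comm, ← integral_const_mul]
  symm
  refine (cov (f := fun z => (z^3)⁻¹) (f' := fun z => - (3 * z^2) / (z^3)^2) measurableSet_Ioi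
    ?_ ?_ ?_ ?_).1
  · intro x hx
    have h0 : x ≠ 0 := by linarith [mem_Ioi.1 hx]
    have h := (hasDerivAt_pow 3 x).inv (pow_ne_zero 3 h0)
    norm_num at h
    exact h
  · intro x hx y hy hxy
    exact (pow_left_inj₀ (by linarith [mem_Ioi.1 hx]) (by linarith [mem_Ioi.1 hy])
      (by norm_num)).1 (inv_inj.1 hxy)
  · ext s
    constructor
    · rintro ⟨x, hx, rfl⟩
      have h1 : 1 < x^3 := one_lt_pow₀ hx (by norm_num)
      exact ⟨by simp only; positivity, inv_lt_one_of_one_lt₀ h1⟩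
    · intro hs
      refine ⟨s ^ (-(1/3):ℝ), ?_, ?_⟩
      · exact Real.one_lt_rpow_of_pos_of_lt_one_of_neg hs.1 hs.2 (by norm_num)
      · simp only
        rw [← Real.rpow_natCast, ← Real.rpow_mul hs.1.le]
        norm_num [Real.rpow_neg_one]
  · intro z hz
    have hz1 : 1 < z := hz
    have h0 : 0 < z := by linarith
    have h1 : 1 < z^3 := one_lt_pow₀ hz1 (by norm_num)
    have h2 : 0 < z^3 - 1 := by linarith
    have e1 : ((z^3)⁻¹ : ℝ) ^ ((1/6:ℝ) - 1) = z * √(z^3) := by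
      rw [← Real.rpow_natCast, ← Real.rpow_neg h0.le, ← Real.rpow_mul h0.le,
        Real.sqrt_eq_rpow, ← Real.rpow_mul h0.le]
      nth_rewrite 2 [← Real.rpow_one z]
      rw [← Real.rpow_add h0]
      norm_num
    have e2 : (1 - (z^3)⁻¹ : ℝ) ^ ((1/2:ℝ) - 1) = √(z^3) / √(z^3 - 1) := by
      rw [show (1/2:ℝ) - 1 = -(1/2) by norm_num,
        show (1 - (z^3)⁻¹ : ℝ) = (z^3 - 1)/z^3 by field_simp,
        Real.rpow_neg (by positivity), ← Real.sqrt_eq_rpow, sqrt_div h2.le, inv_div]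
    rw [e1, e2, neg_div, abs_neg, abs_of_pos (by positivity)]
    have e3 : √(z^3) * √(z^3) = z^3 := mul_self_sqrt (by positivity)
    have := sqrt_pos.2 h2
    field_simp
    rw [sq, e3]

theorem stmt_5 :
    ∑' n : ℕ, (poch (1/2) n * poch (1/3) n * poch (2/3) n) / (poch 1 n)^3 * ((1:ℝ)) * ((-9:ℝ)/16)^n = 16 * π^2 / (27 * (Real.Gamma (2/3))^6) := by
  have e0 : ∀ n : ℕ, (poch (1/2) n * poch (1/3) n * poch (2/3) n) / (poch 1 n)^3 * ((1:ℝ))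
      * ((-9:ℝ)/16)^n = cco n * (-9/16:ℝ)^n := by
    intro n
    simp only [cco, mul_one]
  have hp : ∑' n, aco n * (-9/16:ℝ)^n
      = π⁻¹ * ∫ x in Ioo 0 π, (5/4 + 3/4 * cos x) ^ (-(1/3):ℝ) := pfaff_hasSum.tsum_eq
  obtain ⟨c, hcdef⟩ : ∃ c : ℝ, c = (2:ℝ)^(1/3:ℝ) := ⟨_, rfl⟩
  have hc : c^3 = 2 := by
    rw [hcdef, ← Real.rpow_natCast, ← Real.rpow_mul (by norm_num)]; norm_num
  have hc1 : 1 < c := by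
    rw [hcdef]; exact Real.one_lt_rpow (by norm_num) (by norm_num)
  have hc2 : (2:ℝ)^(1 - 2 * (1/6):ℝ) = c^2 := by
    rw [hcdef, ← Real.rpow_natCast, ← Real.rpow_mul (by norm_num)]; norm_num
  have hdup := Real.Gamma_mul_Gamma_add_half (1/6)
  rw [hc2, show (1/6:ℝ) + 1/2 = 2/3 by norm_num, show 2 * (1/6:ℝ) = 1/3 by norm_num] at hdup
  have hrefl := Real.Gamma_mul_Gamma_one_sub (1/3)
  rw [show 1 - (1/3:ℝ) = 2/3 by norm_num, show π * (1/3) = π / 3 by ring, sin_pi_div_three] at hrefl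
  have hG : 0 < Gamma (2/3) := Gamma_pos_of_pos (by norm_num)
  have h3 : √3 * √3 = (3:ℝ) := mul_self_sqrt (by norm_num)
  have h3p : 0 < √(3:ℝ) := sqrt_pos.2 (by norm_num)
  have hpi : √π * √π = π := mul_self_sqrt pi_pos.le
  have e1 : Gamma (1/3) = 2 * π / (√3 * Gamma (2/3)) := by
    field_simp at hrefl ⊢
    linarith
  have e2 : Gamma (1/6) = Gamma (1/3) * c^2 * √π / Gamma (2/3) := by
    rw [eq_div_iff hG.ne']; exact hdup
  have hJ : ∫ x in Ioo 0 π, (5/4 + 3/4 * cos x) ^ (-(1/3):ℝ)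
      = 4 * π^2 / (3 * √3 * Gamma (2/3)^3) := by
    rw [← step1.1, step23 hc hc1, ← step4 hc hc1, step5, Gamma_one_half_eq, e2, e1]
    have hpp := pi_pos
    field_simp
    rw [hc, sq, hpi]
    ring
  rw [tsum_congr e0, clausen_tsum, hp, hJ]
  have hpp := pi_pos
  field_simp
  rw [sq (√3), h3]
  norm_num
end

section
/- The series ∑_{n=0}^∞ ((1/2)_n)^3/((1)_n^3) · (1/4)^n equals 8π²·2^{1/3}·√3 / (27·Γ(2/3)^6). -/
open Real

noncomputable def aa (k : ℕ) : ℝ := ∏ i ∈ Finset.range k, ((i:ℝ)+1/4)/((i:ℝ)+1)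
noncomputable def bb (k : ℕ) : ℝ := ∏ i ∈ Finset.range k, ((i:ℝ)+1/2)/((i:ℝ)+1)
noncomputable def cc (k : ℕ) : ℝ := aa k ^ 2

lemma bb_succ (k : ℕ) : bb (k+1) = bb k * (((k:ℝ)+1/2)/((k:ℝ)+1)) := by
  exact Finset.prod_range_succ _ _
lemma cc_succ (k : ℕ) : cc (k+1) = cc k * ((k:ℝ)+1/4)^2/((k:ℝ)+1)^2 := by
  simp only [cc, aa, Finset.prod_range_succ]; rw [mul_pow, div_pow, mul_div_assoc]
lemma bb_zero : bb 0 = 1 := by simp [bb]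
lemma cc_zero : cc 0 = 1 := by simp [cc, aa]
lemma cc_nonneg (k : ℕ) : 0 ≤ cc k := sq_nonneg _
lemma cc_le (k : ℕ) : cc k ≤ 1 := by
  induction k with
  | zero => rw [cc_zero]
  | succ k ih =>
    rw [cc_succ, div_le_one (by positivity)]
    have : ((k:ℝ)+1/4)^2 ≤ ((k:ℝ)+1)^2 := by gcongr; norm_num
    nlinarith [cc_nonneg k, sq_nonneg ((k:ℝ)+1/4)]
lemma bb_nonneg (k : ℕ) : 0 ≤ bb k := Finset.prod_nonneg fun i _ => by positivity
lemma bb_le (k : ℕ) : bb k ≤ 1 := by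
  refine Finset.prod_le_one (fun i _ => by positivity) fun i _ => ?_
  rw [div_le_one (by positivity)]; linarith

lemma poch_ratio (n : ℕ) : poch (1/2) n = bb n * poch 1 n ∧ 0 < poch 1 n := by
  induction n with
  | zero => simp [poch, bb_zero]
  | succ n ih =>
    have h : ∀ a : ℝ, poch a (n+1) = poch a n * (a + n) := fun a => by
      simp [poch, ascPochhammer_succ_eval]
    rw [h, h, ih.1, bb_succ]
    refine ⟨?_, mul_pos ih.2 (by positivity)⟩
    field_simp; ring

/-- Clausen-type coefficient identity. -/
lemma clausen_s9 (n : ℕ) : ∑ k ∈ Finset.range (n+1), cc k * cc (n-k) = bb n ^ 3 := by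
  induction n with
  | zero => simp [cc_zero, bb_zero]
  | succ n ih =>
    set g : ℕ → ℝ := fun k => (k:ℝ)^2 * (2*k - 3*(n+1)) * cc k * cc (n+1-k) with hg
    have h1 : ∑ k ∈ Finset.range (n+1), (((n:ℝ)+1)^3 * (cc k * cc (n+1-k)) -
        ((n:ℝ)+1/2)^3 * (cc k * cc (n-k))) = g (n+1) - g 0 := by
      rw [← Finset.sum_range_sub]
      refine Finset.sum_congr rfl fun k hk => ?_
      obtain ⟨m, rfl⟩ : ∃ m, n = k + m := ⟨n-k, by simp at hk; omega⟩
      have e1 : k + m + 1 - k = m + 1 := by omega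
      have e2 : k + m - k = m := by omega
      have e3 : k + m + 1 - (k+1) = m := by omega
      simp only [hg, e1, e2, e3, cc_succ]
      push_cast
      field_simp
      ring
    rw [Finset.sum_sub_distrib, ← Finset.mul_sum, ← Finset.mul_sum, ih] at h1
    rw [Finset.sum_range_succ, bb_succ]
    simp only [hg, Nat.sub_self, cc_zero] at h1 ⊢
    push_cast at h1
    have : ((n:ℝ)+1)^3 ≠ 0 := by positivity
    field_simp
    field_simp at h1
    linarith

lemma choose_real (k m : ℕ) : ((m:ℝ)+1) * (k.choose (m+1)) = ((k:ℝ)-m) * k.choose m := by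
  rcases le_or_gt m k with h | h
  · have := Nat.choose_succ_right_eq k m
    have h2 : ((k - m : ℕ):ℝ) = (k:ℝ) - m := by push_cast [h]; ring
    rw [← h2]
    have h3 : ((k.choose (m+1) * (m+1) : ℕ):ℝ) = (k.choose m * (k-m) : ℕ) := by rw [this]
    push_cast at h3 ⊢
    linarith
  · simp [Nat.choose_eq_zero_of_lt h, Nat.choose_eq_zero_of_lt (Nat.lt_succ_of_lt h)]

/-- quadratic transformation coefficient identity. -/
lemma quad (n : ℕ) : ∑ k ∈ Finset.range (n+1), cc k * 4^k * (-1)^(n+k) * (k.choose (n-k) : ℝ)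
    = bb n ^ 2 := by
  induction n with
  | zero => simp [cc_zero, bb_zero]
  | succ n ih =>
    set g : ℕ → ℝ := fun k => (k:ℝ) * ((n+2-k : ℕ):ℝ) * (cc k * 4^k * (-1)^(n+k))
      * (k.choose (n+2-k) : ℝ) with hg
    have h1 : ∑ k ∈ Finset.range (n+1), (((n:ℝ)+1)^2 * (cc k * 4^k * (-1)^(n+1+k) *
          (k.choose (n+1-k) : ℝ)) -
        ((n:ℝ)+1/2)^2 * (cc k * 4^k * (-1)^(n+k) * (k.choose (n-k) : ℝ))) = g (n+1) - g 0 := by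
      rw [← Finset.sum_range_sub]
      refine Finset.sum_congr rfl fun k hk => ?_
      obtain ⟨m, rfl⟩ : ∃ m, n = k + m := ⟨n-k, by simp at hk; omega⟩
      have e1 : k + m + 1 - k = m + 1 := by omega
      have e2 : k + m - k = m := by omega
      have e3 : k + m + 2 - (k+1) = m + 1 := by omega
      have e4 : k + m + 2 - k = m + 2 := by omega
      have c1 := choose_real k m
      have c2 := choose_real k (m+1)
      have c3 : ((k:ℝ)+1) * k.choose m = (k+1).choose (m+1) * ((m:ℝ)+1) := by
        exact_mod_cast Nat.add_one_mul_choose_eq k m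
      simp only [hg, e1, e2, e3, e4, cc_succ]
      have p1 : ((-1:ℝ))^(k+m+1+k) = -(-1)^(k+m+k) := by ring
      have p2 : ((-1:ℝ))^(k+m+(k+1)) = -(-1)^(k+m+k) := by ring
      rw [p1, p2]
      generalize ((-1:ℝ))^(k+m+k) = s
      push_cast at *
      have t1 : ((k:ℝ)+1)*((m:ℝ)+1) * (cc k * ((k:ℝ)+1/4)^2/((k:ℝ)+1)^2 * 4^(k+1) * -s) *
          ((k+1).choose (m+1)) = -(cc k * (4*(k:ℝ)+1)^2/4 * 4^k * s) * k.choose m := by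
        have : ((k+1).choose (m+1):ℝ) = ((k:ℝ)+1) * k.choose m / ((m:ℝ)+1) := by
          rw [c3]; field_simp
        rw [this, pow_succ]; field_simp; ring
      have t2 : (k:ℝ) * ((m:ℝ)+2) * (cc k * 4^k * s) * (k.choose (m+2)) =
          k * (cc k * 4^k * s) * ((k - (m+1)) * (k.choose (m+1))) := by
        rw [← c2]; ring
      rw [t1, t2]
      have c4 : (k.choose (m+1) : ℝ) = (k-m) * k.choose m / (m+1) := by
        rw [← c1]; field_simp
      rw [c4]; field_simp; ring
    rw [Finset.sum_sub_distrib, ← Finset.mul_sum, ← Finset.mul_sum, ih] at h1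
    rw [Finset.sum_range_succ, bb_succ]
    have e5 : n + 2 - (n+1) = 1 := by omega
    have p3 : ((-1:ℝ))^(n+1+(n+1)) = -(-1)^(n+(n+1)) := by ring
    simp only [hg, Nat.sub_self, e5, p3] at h1 ⊢
    push_cast at h1 ⊢
    simp at h1 ⊢
    have : ((n:ℝ)+1)^2 ≠ 0 := by positivity
    field_simp
    field_simp at h1
    linarith

lemma half_conv (n : ℕ) : ∑ k ∈ Finset.range (n+1), bb k * bb (n-k) = 1 := by
  induction n with
  | zero => simp [bb_zero]
  | succ n ih =>
    set g : ℕ → ℝ := fun k => -(k:ℝ) * bb k * bb (n+1-k) with hg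
    have h1 : ∑ k ∈ Finset.range (n+1), (((n:ℝ)+1) * (bb k * bb (n+1-k)) -
        ((n:ℝ)+1) * (bb k * bb (n-k))) = g (n+1) - g 0 := by
      rw [← Finset.sum_range_sub]
      refine Finset.sum_congr rfl fun k hk => ?_
      obtain ⟨m, rfl⟩ : ∃ m, n = k + m := ⟨n-k, by simp at hk; omega⟩
      have e1 : k + m + 1 - k = m + 1 := by omega
      have e2 : k + m - k = m := by omega
      have e3 : k + m + 1 - (k+1) = m := by omega
      simp only [hg, e1, e2, e3, bb_succ]
      push_cast
      field_simp
      ring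
    rw [Finset.sum_sub_distrib, ← Finset.mul_sum, ← Finset.mul_sum, ih] at h1
    rw [Finset.sum_range_succ]
    simp only [hg, Nat.sub_self, bb_zero] at h1 ⊢
    push_cast at h1
    have h2 : ((n:ℝ)+1) ≠ 0 := by positivity
    apply mul_left_cancel₀ h2
    linarith

lemma bb_summable {y : ℝ} (h0 : 0 ≤ y) (h1 : y < 1) : Summable fun n => bb n * y^n := by
  refine Summable.of_nonneg_of_le (fun n => mul_nonneg (bb_nonneg n) (by positivity))
    (fun n => ?_) (summable_geometric_of_lt_one h0 h1)
  exact mul_le_of_le_one_left (by positivity) (bb_le n)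

lemma cc_summable {y : ℝ} (h0 : 0 ≤ y) (h1 : y < 1) : Summable fun n => cc n * y^n := by
  refine Summable.of_nonneg_of_le (fun n => mul_nonneg (cc_nonneg n) (by positivity))
    (fun n => ?_) (summable_geometric_of_lt_one h0 h1)
  exact mul_le_of_le_one_left (by positivity) (cc_le n)

lemma half_series {y : ℝ} (h0 : 0 ≤ y) (h1 : y < 1) : ∑' n, bb n * y^n = 1 / √(1-y) := by
  have hs := bb_summable h0 h1
  have h := tsum_mul_tsum_eq_tsum_sum_range_of_summable_norm hs.norm hs.norm
  have h2 : ∀ n, ∑ k ∈ Finset.range (n+1), bb k * y^k * (bb (n-k) * y^(n-k)) = y^n := by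
    intro n
    rw [← one_mul (y^n), ← half_conv n, Finset.sum_mul]
    refine Finset.sum_congr rfl fun k hk => ?_
    obtain ⟨m, rfl⟩ : ∃ m, n = k + m := ⟨n-k, by simp at hk; omega⟩
    rw [Nat.add_sub_cancel_left, pow_add]; ring
  simp only [h2] at h
  rw [tsum_geometric_of_lt_one h0 h1] at h
  have hp : 0 ≤ ∑' n, bb n * y^n := tsum_nonneg fun n => mul_nonneg (bb_nonneg n) (by positivity)
  rw [one_div, ← Real.sqrt_inv, ← h, Real.sqrt_mul_self hp]

lemma clausen_series : ∑' n, bb n ^ 3 * (1/4:ℝ)^n = (∑' n, cc n * (1/4:ℝ)^n)^2 := by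
  have hs := cc_summable (y := 1/4) (by norm_num) (by norm_num)
  rw [sq, tsum_mul_tsum_eq_tsum_sum_range_of_summable_norm hs.norm hs.norm]
  refine tsum_congr fun n => ?_
  rw [← clausen_s9 n, Finset.sum_mul]
  refine Finset.sum_congr rfl fun k hk => ?_
  obtain ⟨m, rfl⟩ : ∃ m, n = k + m := ⟨n-k, by simp at hk; omega⟩
  rw [Nat.add_sub_cancel_left, pow_add]; ring

lemma binom_hasSum (k : ℕ) (z : ℝ) : HasSum (fun j : ℕ => (k.choose j : ℝ) * z^j) ((1+z)^k) := by
  have : (1+z)^k = ∑ j ∈ Finset.range (k+1), (k.choose j : ℝ) * z^j := by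
    rw [add_comm, add_pow]
    refine Finset.sum_congr rfl fun j _ => by simp; ring
  rw [this]
  refine hasSum_sum_of_ne_finset_zero fun j hj => ?_
  rw [Nat.choose_eq_zero_of_lt (by simpa [Nat.lt_succ_iff] using hj)]; simp

lemma quad_series {x : ℝ} (h0 : 0 ≤ x) (h1 : 4*x*(1+x) < 1) :
    ∑' k, cc k * (4*x*(1-x))^k = ∑' n, bb n ^ 2 * x^n := by
  set F : ℕ × ℕ → ℝ := fun p => cc p.1 * (4*x)^p.1 * ((p.1.choose p.2 : ℝ) * (-x)^p.2) with hF
  have hsum : Summable F := by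
    rw [← summable_norm_iff]
    have e : ∀ p, ‖F p‖ = cc p.1 * (4*x)^p.1 * ((p.1.choose p.2 : ℝ) * x^p.2) := by
      intro p
      simp only [hF, norm_mul, norm_pow, norm_neg, Real.norm_eq_abs]
      rw [abs_of_nonneg (cc_nonneg _), abs_of_nonneg h0, abs_of_nonneg (Nat.cast_nonneg _)]
      simp
    rw [summable_prod_of_nonneg (fun p => norm_nonneg _)]
    simp only [e]
    refine ⟨fun k => ((binom_hasSum k x).mul_left _).summable, ?_⟩
    simp only [((binom_hasSum _ x).mul_left _).tsum_eq]
    refine (cc_summable (y := 4*x*(1+x)) (by positivity) h1).congr fun k => ?_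
    rw [mul_pow (4*x)]; ring
  have l : ∑' p, F p = ∑' k, cc k * (4*x*(1-x))^k := by
    rw [hsum.tsum_prod]
    refine tsum_congr fun k => ?_
    simp only [hF]
    rw [((binom_hasSum k (-x)).mul_left _).tsum_eq, mul_pow (4*x)]; ring
  rw [← l, ← Finset.HasAntidiagonal.sigmaAntidiagonalEquivProd.tsum_eq F]
  refine Eq.trans ((Finset.HasAntidiagonal.sigmaAntidiagonalEquivProd.summable_iff.mpr
    hsum).tsum_sigma' (fun n ↦ (hasSum_fintype _).summable)) ?_
  refine tsum_congr fun n => ?_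
  rw [tsum_fintype, ← quad n, Finset.sum_mul]
  have := Finset.Nat.sum_antidiagonal_eq_sum_range_succ_mk F n
  rw [← Finset.sum_coe_sort] at this
  refine Eq.trans this (Finset.sum_congr rfl fun k hk => ?_)
  obtain ⟨m, rfl⟩ : ∃ m, n = k + m := ⟨n-k, by simp at hk; omega⟩
  simp only [hF, Nat.add_sub_cancel_left]
  have p : (-1:ℝ)^(k+m+k) = (-1)^m := by
    rw [show k+m+k = m + 2*k by ring, pow_add, pow_mul]; simp
  rw [p, neg_pow x, mul_pow, pow_add]; ring

lemma sin_int (n : ℕ) : ∫ φ in (0:ℝ)..π, sin φ ^ (2*n) = π * bb n := by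
  rw [integral_sin_pow_even, bb]
  congr 1
  refine Finset.prod_congr rfl fun i _ => ?_
  field_simp

lemma K_series {x : ℝ} (h0 : 0 ≤ x) (h1 : x < 1) :
    π * ∑' n, bb n ^ 2 * x^n = ∫ φ in (0:ℝ)..π, 1 / √(1 - x * sin φ ^ 2) := by
  have hh := intervalIntegral.hasSum_integral_of_dominated_convergence (μ := MeasureTheory.volume)
    (a := 0) (b := π)
    (F := fun n φ => bb n * (x * sin φ ^ 2)^n) (f := fun φ => 1 / √(1 - x * sin φ ^ 2))
    (fun n _ => x^n) (fun n => by
      apply Continuous.aestronglyMeasurable; fun_prop) ?_ ?_ ?_ ?_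
  · rw [← hh.tsum_eq, ← tsum_mul_left]
    refine tsum_congr fun n => ?_
    simp only [mul_pow, ← pow_mul]
    rw [intervalIntegral.integral_const_mul, intervalIntegral.integral_const_mul, sin_int]; ring
  · intro n
    refine Filter.Eventually.of_forall fun φ _ => ?_
    have hb := sin_sq_le_one φ
    rw [Real.norm_of_nonneg (mul_nonneg (bb_nonneg n) (by positivity))]
    calc bb n * (x * sin φ ^ 2)^n ≤ 1 * (x*1)^n := by gcongr; exact bb_le n
      _ = x^n := by simp
  · exact Filter.Eventually.of_forall fun φ _ => summable_geometric_of_lt_one h0 h1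
  · simp
  · refine Filter.Eventually.of_forall fun φ _ => ?_
    have hb := sin_sq_le_one φ
    have a1 : 0 ≤ x * sin φ ^ 2 := by positivity
    have a2 : x * sin φ ^ 2 < 1 := by nlinarith
    rw [← half_series a1 a2]
    exact (bb_summable a1 a2).hasSum

lemma beta_real : ∫ v in Set.Ioo (0:ℝ) 1, v^(-(5/6):ℝ) * (1-v)^(-(1/2):ℝ) =
    Real.Gamma (1/6) * Real.Gamma (1/2) / Real.Gamma (2/3) := by
  have h := Complex.betaIntegral_eq_Gamma_mul_div ((1/6:ℝ):ℂ) ((1/2:ℝ):ℂ)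
    (by rw [Complex.ofReal_re]; norm_num) (by rw [Complex.ofReal_re]; norm_num)
  rw [← Complex.ofReal_add, Complex.Gamma_ofReal, Complex.Gamma_ofReal, Complex.Gamma_ofReal,
    show (1/6:ℝ)+1/2 = 2/3 by norm_num] at h
  have h2 : Complex.betaIntegral ((1/6:ℝ):ℂ) ((1/2:ℝ):ℂ) =
      ((∫ v in (0:ℝ)..1, v^(-(5/6):ℝ) * (1-v)^(-(1/2):ℝ) : ℝ) : ℂ) := by
    rw [Complex.betaIntegral, ← intervalIntegral.integral_ofReal]
    refine intervalIntegral.integral_congr fun v hv => ?_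
    rw [Set.uIcc_of_le zero_le_one] at hv
    rw [Complex.ofReal_mul, Complex.ofReal_cpow hv.1, Complex.ofReal_cpow (by linarith [hv.2])]
    push_cast
    norm_num
  rw [h2] at h
  rw [← MeasureTheory.integral_Ioc_eq_integral_Ioo, ← intervalIntegral.integral_of_le zero_le_one]
  exact_mod_cast h

lemma sqrt3_bounds : 1 < √3 ∧ √3 < 2 ∧ √3 * √3 = 3 := by
  refine ⟨?_, ?_, ?_⟩
  · rw [Real.lt_sqrt] <;> norm_num
  · rw [Real.sqrt_lt'] <;> norm_num
  · rw [Real.mul_self_sqrt]; norm_num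

noncomputable def qq (φ : ℝ) : ℝ := (1 - cos φ) / ((1+√3) + (√3-1) * cos φ)

lemma cos_bounds {φ : ℝ} (h : φ ∈ Set.Ioo 0 π) : -1 < cos φ ∧ cos φ < 1 ∧ 0 < sin φ := by
  have hs := sin_pos_of_mem_Ioo h
  have := sin_sq_add_cos_sq φ
  refine ⟨?_, ?_, hs⟩ <;> nlinarith [cos_le_one φ, neg_one_le_cos φ]

lemma DD_pos {c : ℝ} (h : -1 < c) : 0 < (1+√3) + (√3-1) * c := by
  obtain ⟨h1, h2, h3⟩ := sqrt3_bounds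
  nlinarith

lemma qq_deriv {φ : ℝ} (h : φ ∈ Set.Ioo 0 π) :
    HasDerivAt (fun φ => qq φ ^ 3)
      (3 * qq φ ^ 2 * (2 * √3 * sin φ / ((1+√3) + (√3-1) * cos φ)^2)) φ := by
  have hD := DD_pos (cos_bounds h).1
  have h1 : HasDerivAt (fun φ => 1 - cos φ) (sin φ) φ := by
    simpa using (hasDerivAt_cos φ).const_sub 1
  have h2 : HasDerivAt (fun φ => (1+√3) + (√3-1) * cos φ) ((√3-1) * (-sin φ)) φ :=
    ((hasDerivAt_cos φ).const_mul _).const_add _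
  have h3 := (h1.div h2 hD.ne').pow 3
  refine h3.congr_deriv ?_
  simp only [qq, Pi.div_apply]
  push_cast
  field_simp
  ring

lemma qq_range {φ : ℝ} (h : φ ∈ Set.Ioo 0 π) : 0 < qq φ ∧ qq φ < 1 := by
  obtain ⟨a, b, c⟩ := cos_bounds h
  have hD := DD_pos a
  obtain ⟨h1, h2, h3⟩ := sqrt3_bounds
  refine ⟨div_pos (by linarith) hD, ?_⟩
  rw [qq, div_lt_one hD]; nlinarith

lemma qq_inj : Set.InjOn (fun φ => qq φ ^ 3) (Set.Ioo 0 π) := by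
  intro u hu v hv huv
  have hq : qq u = qq v := by
    exact (pow_left_inj₀ (qq_range hu).1.le (qq_range hv).1.le (by norm_num)).mp huv
  have du := DD_pos (cos_bounds hu).1
  have dv := DD_pos (cos_bounds hv).1
  rw [qq, qq, div_eq_div_iff du.ne' dv.ne'] at hq
  obtain ⟨h1, h2, h3⟩ := sqrt3_bounds
  have hc : cos u = cos v := by
    have : √3 * (cos u - cos v) = 0 := by linarith
    rcases mul_eq_zero.mp this with h | h <;> linarith
  exact injOn_cos (Set.Ioo_subset_Icc_self hu) (Set.Ioo_subset_Icc_self hv) hc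

lemma qq_image : (fun φ => qq φ ^ 3) '' (Set.Ioo 0 π) = Set.Ioo 0 1 := by
  ext v
  constructor
  · rintro ⟨φ, hφ, rfl⟩
    obtain ⟨a, b⟩ := qq_range hφ
    exact ⟨by positivity, pow_lt_one₀ a.le b (by norm_num)⟩
  · rintro ⟨h0, h1⟩
    obtain ⟨s1, s2, s3⟩ := sqrt3_bounds
    set q := v^((1:ℝ)/3) with hq
    have q0 : 0 < q := rpow_pos_of_pos h0 _
    have q1 : q < 1 := rpow_lt_one h0.le h1 (by norm_num)
    have q3 : q^3 = v := by
      rw [hq, ← rpow_natCast, ← rpow_mul h0.le]; norm_num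
    set c := (1 - q*(1+√3))/(1+q*(√3-1)) with hc
    have hd : 0 < 1+q*(√3-1) := by nlinarith
    have c0 : -1 < c := by rw [hc, lt_div_iff₀ hd]; nlinarith
    have c1 : c < 1 := by rw [hc, div_lt_one hd]; nlinarith
    refine ⟨arccos c, ⟨arccos_pos.mpr c1, ?_⟩, ?_⟩
    · refine lt_of_le_of_ne (arccos_le_pi c) fun h => ?_
      rw [arccos_eq_pi] at h; linarith
    · have : qq (arccos c) = q := by
        rw [qq, cos_arccos c0.le c1.le, div_eq_iff (DD_pos c0).ne', hc]
        field_simp; ring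
      simp only [this, q3]

lemma integrand {φ : ℝ} (h : φ ∈ Set.Ioo 0 π) :
    |3 * qq φ ^ 2 * (2 * √3 * sin φ / ((1+√3) + (√3-1) * cos φ)^2)| *
      ((qq φ ^ 3)^(-(5/6):ℝ) * (1-qq φ ^ 3)^(-(1/2):ℝ)) =
    3 / √(√3) * (1 / √(1 - (2-√3)/4 * sin φ ^ 2)) := by
  obtain ⟨q0, q1⟩ := qq_range h
  obtain ⟨c0, c1, s0⟩ := cos_bounds h
  obtain ⟨s1, s2, s3⟩ := sqrt3_bounds
  have hD := DD_pos c0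
  have hv : 0 < 1 - qq φ ^ 3 := by
    have := pow_lt_one₀ q0.le q1 (n := 3) (by norm_num); linarith
  have hw : 0 < 1 - (2-√3)/4 * sin φ ^ 2 := by nlinarith [sin_sq_le_one φ]
  rw [abs_of_nonneg (by positivity)]
  rw [← sq_eq_sq₀ (by positivity) (by positivity)]
  have e1 : ((qq φ ^ 3)^(-(5/6):ℝ))^2 = (qq φ ^ 5)⁻¹ := by
    rw [← rpow_natCast (qq φ) 3, ← rpow_mul q0.le, ← rpow_natCast, ← rpow_mul q0.le,
      ← rpow_natCast (qq φ) 5, ← rpow_neg q0.le]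
    norm_num
  have e2 : ((1-qq φ ^ 3)^(-(1/2):ℝ))^2 = (1-qq φ ^ 3)⁻¹ := by
    rw [← rpow_natCast, ← rpow_mul hv.le, ← rpow_neg_one]; norm_num
  simp only [mul_pow, e1, e2, div_pow, Real.sq_sqrt hw.le, Real.sq_sqrt (sqrt_nonneg 3)]
  have e3 : 1 - qq φ ^ 3 = 12 * √3 * (1+cos φ) * (1 - (2-√3)/4 * sin φ ^ 2) /
      ((1+√3) + (√3-1) * cos φ)^3 := by
    rw [qq, sin_sq, eq_div_iff (by positivity), sub_mul, div_pow, div_mul_cancel₀ _ (by positivity)]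
    have s4 : √3^2 = 3 := by rw [sq, s3]
    have s5 : √3^3 = 3*√3 := by rw [pow_succ, s4]
    ring_nf
    simp only [s4, s5]
    ring
  rw [e3, qq]
  have hp : 0 < 1 - cos φ := by linarith
  have hr : 0 < 1 + cos φ := by linarith
  set w := 1 - (2-√3)/4 * sin φ ^ 2
  set D := (1+√3) + (√3-1) * cos φ
  have s4 : √3^2 = 3 := by rw [sq, s3]
  have hss : sin φ ^ 2 = (1-cos φ)*(1+cos φ) := by rw [sin_sq]; ring
  rw [hss]
  field_simp
  nlinarith

lemma K_eval : ∫ φ in (0:ℝ)..π, 1 / √(1 - (2-√3)/4 * sin φ ^ 2) =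
    √(√3) / 3 * (Real.Gamma (1/6) * Real.Gamma (1/2) / Real.Gamma (2/3)) := by
  rw [intervalIntegral.integral_of_le pi_pos.le, MeasureTheory.integral_Ioc_eq_integral_Ioo,
    ← beta_real, ← qq_image, MeasureTheory.integral_image_eq_integral_abs_deriv_smul
    measurableSet_Ioo (fun φ hφ => (qq_deriv hφ).hasDerivWithinAt) qq_inj]
  simp only [smul_eq_mul]
  rw [MeasureTheory.setIntegral_congr_fun measurableSet_Ioo (fun φ hφ => integrand hφ),
    MeasureTheory.integral_const_mul]
  have : 0 < √(√3) := by positivity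
  field_simp

lemma gamma_eval : Real.Gamma (1/6) * Real.Gamma (1/2) / Real.Gamma (2/3) =
    (2:ℝ)^((2:ℝ)/3) * π * (2 * π / √3) / Real.Gamma (2/3)^3 := by
  have h1 := Real.Gamma_mul_Gamma_add_half (1/6)
  have h2 := Real.Gamma_mul_Gamma_one_sub (1/3)
  rw [show π * (1/3) = π/3 by ring, sin_pi_div_three] at h2
  norm_num at h1 h2
  have g : 0 < Real.Gamma (2/3) := Gamma_pos_of_pos (by norm_num)
  have g3 : Real.Gamma (1/3) = π / (√3/2) / Real.Gamma (2/3) := by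
    rw [← h2]; field_simp
  have g6 : Real.Gamma (1/6) = Real.Gamma (1/3) * 2^((2:ℝ)/3) * √π / Real.Gamma (2/3) := by
    rw [← h1]; field_simp
  have hpi : √π * √π = π := Real.mul_self_sqrt pi_pos.le
  rw [g6, g3, Real.Gamma_one_half_eq]
  field_simp
  rw [sq, hpi]

theorem stmt_9 :
    ∑' n : ℕ, (poch (1/2) n * poch (1/2) n * poch (1/2) n) / (poch 1 n)^3 * ((1:ℝ)) * ((1:ℝ)/4)^n = 8 * π^2 * (2:ℝ)^((1:ℝ)/3) * Real.sqrt 3 / (27 * (Real.Gamma (2/3))^6) := by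
  have e : ∀ n : ℕ, (poch (1/2) n * poch (1/2) n * poch (1/2) n) / (poch 1 n)^3 * ((1:ℝ)) *
      ((1:ℝ)/4)^n = bb n ^ 3 * (1/4:ℝ)^n := by
    intro n
    obtain ⟨h1, h2⟩ := poch_ratio n
    rw [h1]; field_simp
  obtain ⟨s1, s2, s3⟩ := sqrt3_bounds
  have hx : 4 * ((2-√3)/4) * (1 - (2-√3)/4) = 1/4 := by linarith
  have hx2 : 4 * ((2-√3)/4) * (1 + (2-√3)/4) < 1 := by
    have : 1.7 < √3 := by rw [Real.lt_sqrt] <;> norm_num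
    nlinarith
  have hq := quad_series (x := (2-√3)/4) (by linarith) hx2
  rw [hx] at hq
  have hk := K_series (x := (2-√3)/4) (by linarith) (by linarith)
  rw [← hq, K_eval, gamma_eval] at hk
  simp only [e]
  rw [clausen_series]
  have hk2 : ∑' n, cc n * (1/4:ℝ)^n = √(√3) / 3 * ((2:ℝ)^((2:ℝ)/3) * π * (2 * π / √3) /
      Real.Gamma (2/3)^3) / π := by
    rw [← hk]; field_simp
  rw [hk2]
  have g : 0 < Real.Gamma (2/3) := Gamma_pos_of_pos (by norm_num)
  have p : ((2:ℝ)^((2:ℝ)/3))^2 = 2 * (2:ℝ)^((1:ℝ)/3) := by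
    have h : (2:ℝ) * (2:ℝ)^((1:ℝ)/3) = (2:ℝ)^(1+(1:ℝ)/3) := by
      rw [rpow_add (by norm_num), rpow_one]
    rw [h, ← rpow_natCast, ← rpow_mul (by norm_num)]; norm_num
  have s4 : √3^2 = 3 := by rw [sq, s3]
  have s5 : √(√3)^2 = √3 := Real.sq_sqrt (sqrt_nonneg 3)
  simp only [mul_pow, div_pow, p, s4, s5]
  field_simp
  ring
end
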